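/- (Hermitian balanced structures on the solvable Lie algebra s₂.) For every real t ≠ 0, the 2-form F_t = t²·β¹² + β³⁴ + β⁵⁶ and the complex 3-form Ψ_t = t·(β¹ + iβ²)∧(β³ + iβ⁴)∧(β⁵ + iβ⁶) satisfy d(F_t∧F_t) = 0 and dΨ_t = 0 (i.e., d(Re Ψ_t) = 0 and d(Im Ψ_t) = 0). Hence (F_t, Ψ_t) is a one-parameter family of Hermitian balanced SU(3) structures on s₂. -/

import Mathlib

noncomputable section

/-- `Λ`, the exterior algebra over `ℝ` on six degree-one generators. -/
abbrev Lam : Type := ExteriorAlgebra ℝ (Fin 6 → ℝ)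

/-- The six degree-one generators (indexed from `0`, so `β 0` is the paper's `β¹`
or `e¹`, …, `β 5` is `β⁶` or `e⁶`). -/
def β (i : Fin 6) : Lam := ExteriorAlgebra.ι ℝ (Pi.single i 1)

/-- The real part of the product `(x₁ + i y₁) ∧ (x₂ + i y₂) ∧ (x₃ + i y₃)` of
complex-coefficient forms in `Λ ⊗ ℂ`, expressed in terms of real forms. -/
def reProd3 (x₁ y₁ x₂ y₂ x₃ y₃ : Lam) : Lam :=
  x₁ * x₂ * x₃ - x₁ * y₂ * y₃ - y₁ * x₂ * y₃ - y₁ * y₂ * x₃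

/-- The imaginary part of the product `(x₁ + i y₁) ∧ (x₂ + i y₂) ∧ (x₃ + i y₃)` of
complex-coefficient forms in `Λ ⊗ ℂ`, expressed in terms of real forms. -/
def imProd3 (x₁ y₁ x₂ y₂ x₃ y₃ : Lam) : Lam :=
  x₁ * x₂ * y₃ + x₁ * y₂ * x₃ + y₁ * x₂ * x₃ - y₁ * y₂ * y₃

/-- The graded Leibniz rule: `d (x ∧ y) = dx ∧ y + (-1)^p x ∧ dy` for `p`-forms `x`. -/
def IsLeibniz (d : Lam →ₗ[ℝ] Lam) : Prop :=
  ∀ (p : ℕ) (x y : Lam), x ∈ ⋀[ℝ]^p (Fin 6 → ℝ) →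
    d (x * y) = d x * y + ((-1 : ℝ) ^ p) • (x * d y)

theorem β_mul_self (i : Fin 6) : β i * β i = 0 :=
  ExteriorAlgebra.ι_sq_zero _

theorem β_mul_self_mul (i : Fin 6) (x : Lam) : β i * (β i * x) = 0 := by
  rw [← mul_assoc, β_mul_self, zero_mul]

theorem β_mul_comm (i j : Fin 6) : β j * β i = -(β i * β j) :=
  eq_neg_of_add_eq_zero_left (ExteriorAlgebra.ι_add_mul_swap _ _)

/-- Reorders two generators into increasing order. -/
theorem β_mul_of_lt {i j : Fin 6} (_ : i < j) : β j * β i = -(β i * β j) :=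
  β_mul_comm i j

theorem β_mul_mul_of_lt {i j : Fin 6} (_ : i < j) (x : Lam) :
    β j * (β i * x) = -(β i * (β j * x)) := by
  rw [← mul_assoc, β_mul_comm, neg_mul, mul_assoc]

theorem IsLeibniz.map_β_mul {d : Lam →ₗ[ℝ] Lam} (hd : IsLeibniz d) (i : Fin 6) (x : Lam) :
    d (β i * x) = d (β i) * x - β i * d x := by
  have hi : β i ∈ ⋀[ℝ]^1 (Fin 6 → ℝ) := by
    rw [ExteriorAlgebra.exteriorPower, pow_one]
    exact LinearMap.mem_range_self _ _
  rw [hd 1 _ _ hi, pow_one, neg_one_smul, sub_eq_add_neg]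

/-- Hermitian balanced structures on the solvable Lie algebra
`s₂ = (0,0,-13-24,-14+23,15+26,16-25)` (the Nakamura manifold's Lie algebra):
for every `t ≠ 0`, `F_t = t² β¹² + β³⁴ + β⁵⁶` and
`Ψ_t = t (β¹ + iβ²)(β³ + iβ⁴)(β⁵ + iβ⁶)` satisfy `d (F_t ∧ F_t) = 0`,
`d (Re Ψ_t) = 0` and `d (Im Ψ_t) = 0`; hence `(F_t, Ψ_t)` is a one-parameter
family of Hermitian balanced SU(3) structures. -/
theorem s2_hermitian_balanced
    (d : Lam →ₗ[ℝ] Lam) (hleib : IsLeibniz d)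
    (h1 : d (β 0) = 0) (h2 : d (β 1) = 0)
    (h3 : d (β 2) = -(β 0 * β 2) - β 1 * β 3)
    (h4 : d (β 3) = -(β 0 * β 3) + β 1 * β 2)
    (h5 : d (β 4) = β 0 * β 4 + β 1 * β 5)
    (h6 : d (β 5) = β 0 * β 5 - β 1 * β 4)
    (t : ℝ) (ht : t ≠ 0) :
    d ((t ^ 2 • (β 0 * β 1) + β 2 * β 3 + β 4 * β 5) *
       (t ^ 2 • (β 0 * β 1) + β 2 * β 3 + β 4 * β 5)) = 0 ∧
    d (t • reProd3 (β 0) (β 1) (β 2) (β 3) (β 4) (β 5)) = 0 ∧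
    d (t • imProd3 (β 0) (β 1) (β 2) (β 3) (β 4) (β 5)) = 0 := by
  refine ⟨?_, ?_, ?_⟩ <;>
  · simp (discharger := decide) only [reProd3, imProd3, mul_add, add_mul, mul_sub, sub_mul,
      smul_mul_assoc, mul_smul_comm, mul_assoc, neg_mul, mul_neg, map_add, map_sub, map_neg,
      map_smul, map_zero, hleib.map_β_mul, h1, h2, h3, h4, h5, h6, β_mul_self, β_mul_self_mul,
      β_mul_of_lt, β_mul_mul_of_lt, mul_zero, zero_mul, neg_zero, smul_zero]
    module
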